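/- arXiv:0711.1713 — 5 statements merged into one kernel-verified Lean document; each statement's English description precedes it below -/
import Mathlib

section
/- Let G be a locally finite graph, let x and y be two distinct vertices of G, and let S be a minimal cutset between x and y. Let 𝒞 be a set of cycles of G that generates the cycle space of G over GF(2). Then for every partition of S into two nonempty parts S₁ and S₂, there exists a cycle O ∈ 𝒞 whose vertex set intersects both S₁ and S₂. -/
open Classical in
/-- The edge set of a closed walk, viewed as a vector over GF(2) indexed by the
potential edges (unordered pairs of vertices) of the graph. -/
noncomputable def edgeVec {V : Type} (G : SimpleGraph V) {u : V} (W : G.Walk u u) :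
    Sym2 V → ZMod 2 :=
  fun e => if e ∈ W.edges then 1 else 0

/-- A set `𝒞` of cycles of `G` generates the cycle space of `G` over GF(2):
every element of `𝒞` is a cycle, and the edge vector of every cycle of `G` is a
finite mod-2 sum of edge vectors of (distinct) cycles from `𝒞`. -/
def GeneratesCycleSpace {V : Type} (G : SimpleGraph V)
    (𝒞 : Set (Σ v : V, G.Walk v v)) : Prop :=
  (∀ O ∈ 𝒞, O.2.IsCycle) ∧
  ∀ ⦃u : V⦄ (W : G.Walk u u), W.IsCycle →
    ∃ s : Finset (Σ v : V, G.Walk v v), ↑s ⊆ 𝒞 ∧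
      ∀ e : Sym2 V, edgeVec G W e = ∑ O ∈ s, edgeVec G O.2 e

/-- `S` is a cutset between vertices `x` and `y`: it avoids `x` and `y`, and
every walk from `x` to `y` meets `S`. -/
def IsCutset {V : Type} (G : SimpleGraph V) (x y : V) (S : Set V) : Prop :=
  S ⊆ ({x, y} : Set V)ᶜ ∧ ∀ p : G.Walk x y, ∃ v ∈ S, v ∈ p.support

open Classical in
theorem sum_edges_eq_sum_edgeVec {V : Type} (G : SimpleGraph V) (f : Sym2 V → ZMod 2) {u : V}
    (W : G.Walk u u) (hW : W.IsCycle) (T : Finset (Sym2 V)) (hT : ∀ e ∈ W.edges, e ∈ T) :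
    (W.edges.map f).sum = ∑ e ∈ T, edgeVec G W e * f e := by
  rw [← List.sum_toFinset f hW.isCircuit.isTrail.edges_nodup]
  simp only [edgeVec, ite_mul, one_mul, zero_mul, ← Finset.sum_filter]
  refine Finset.sum_congr ?_ fun _ _ => rfl
  ext e
  simp only [List.mem_toFinset, Finset.mem_filter]
  exact ⟨fun h => ⟨hT e h, h⟩, fun h => h.2⟩

/-- A labelling that sums to zero on a generating set of cycles sums to zero on every cycle. -/
theorem GeneratesCycleSpace.sum_edges_eq_zero {V : Type} {G : SimpleGraph V}
    {𝒞 : Set (Σ v : V, G.Walk v v)} (hgen : GeneratesCycleSpace G 𝒞) (f : Sym2 V → ZMod 2)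
    (hf : ∀ O ∈ 𝒞, (O.2.edges.map f).sum = 0) {u : V} (W : G.Walk u u) (hW : W.IsCycle) :
    (W.edges.map f).sum = 0 := by
  classical
  obtain ⟨s, hs, hsum⟩ := hgen.2 W hW
  let T : Finset (Sym2 V) := W.edges.toFinset ∪ s.biUnion fun O => O.2.edges.toFinset
  rw [sum_edges_eq_sum_edgeVec G f W hW T fun e he => by simp [T, he]]
  simp only [hsum, Finset.sum_mul]
  rw [Finset.sum_comm]
  refine Finset.sum_eq_zero fun O hO => ?_
  rw [← sum_edges_eq_sum_edgeVec G f O.2 (hgen.1 O (hs hO)) T, hf O (hs hO)]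
  intro e he
  exact Finset.mem_union_right _ (Finset.mem_biUnion.2 ⟨O, hO, List.mem_toFinset.2 he⟩)

open Classical in
/-- If a labelling sums to zero on every cycle, shortcutting a walk to a path preserves its sum. -/
theorem sum_edges_bypass {V : Type} {G : SimpleGraph V} (f : Sym2 V → ZMod 2)
    (hf : ∀ ⦃u : V⦄ (W : G.Walk u u), W.IsCycle → (W.edges.map f).sum = 0)
    {u v : V} (p : G.Walk u v) : (p.bypass.edges.map f).sum = (p.edges.map f).sum := by
  induction p with
  | nil => rfl
  | @cons u v w h p ih =>
    rw [SimpleGraph.Walk.bypass]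
    split_ifs with hs
    · have hpath := p.bypass_isPath.takeUntil hs
      have key : f s(u, v) + ((p.bypass.takeUntil u hs).edges.map f).sum = 0 := by
        generalize p.bypass.takeUntil u hs = q at hpath
        by_cases he : s(u, v) ∈ q.edges
        · cases q with
          | nil => exact absurd rfl h.ne
          | @cons _ b _ h' q =>
            rw [SimpleGraph.Walk.cons_isPath_iff] at hpath
            rw [SimpleGraph.Walk.edges_cons, List.mem_cons] at he
            rcases he with he | he
            · obtain rfl : u = b := by
                rcases Sym2.eq_iff.1 he with ⟨h1, h2⟩ | ⟨h1, -⟩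
                · exact absurd h1 h.ne
                · exact h1
              rw [SimpleGraph.Walk.isPath_iff_nil, ← SimpleGraph.Walk.eq_nil_iff_nil] at hpath
              simp [hpath.1, Sym2.eq_swap (a := v) (b := u), CharTwo.add_self_eq_zero]
            · exact absurd (q.snd_mem_support_of_mem_edges he) hpath.2
        · simpa using hf _ ((SimpleGraph.Walk.cons_isCycle_iff q h).2 ⟨hpath, he⟩)
      have hsplit := congrArg (fun q => (q.edges.map f).sum) (p.bypass.take_spec hs)
      simp only [SimpleGraph.Walk.edges_append, List.map_append, List.sum_append] at hsplit
      simp only [SimpleGraph.Walk.edges_cons, List.map_cons, List.sum_cons]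
      rw [← ih, ← hsplit, ← add_assoc, key, zero_add]
    · simp [ih]

/-- If a labelling sums to zero on every cycle, its sum along a walk depends only on the ends. -/
theorem sum_edges_eq_of_cycles {V : Type} {G : SimpleGraph V} (f : Sym2 V → ZMod 2)
    (hf : ∀ ⦃u : V⦄ (W : G.Walk u u), W.IsCycle → (W.edges.map f).sum = 0)
    {u v : V} (p q : G.Walk u v) : (p.edges.map f).sum = (q.edges.map f).sum := by
  classical
  have h := sum_edges_bypass f hf (p.append q.reverse)
  rw [SimpleGraph.Walk.eq_nil_iff_nil.2
    (SimpleGraph.Walk.isPath_iff_nil.1 (p.append q.reverse).bypass_isPath)] at h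
  simp only [SimpleGraph.Walk.edges_nil, SimpleGraph.Walk.edges_append,
    SimpleGraph.Walk.edges_reverse, List.map_append, List.map_reverse, List.sum_append,
    List.sum_reverse, List.map_nil, List.sum_nil] at h
  exact CharTwo.add_eq_zero.1 h.symm

/-- The mod-2 coboundary of a vertex labelling. -/
def coboundary {V : Type} (g : V → ZMod 2) : Sym2 V → ZMod 2 :=
  Sym2.lift ⟨fun a b => g a + g b, fun a b => add_comm (g a) (g b)⟩

theorem sum_edges_coboundary {V : Type} {G : SimpleGraph V} (g : V → ZMod 2) {u v : V}
    (p : G.Walk u v) : (p.edges.map (coboundary g)).sum = g u + g v := by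
  induction p with
  | nil => simp [CharTwo.add_self_eq_zero]
  | @cons u v w h p ih =>
    simp only [SimpleGraph.Walk.edges_cons, List.map_cons, List.sum_cons, ih]
    change g u + g v + (g v + g w) = _
    rw [add_assoc, ← add_assoc (g v), CharTwo.add_self_eq_zero, zero_add]

/-- No proper subset of a minimal cutset is met by every walk. -/
theorem exists_walk_avoiding {V : Type} {G : SimpleGraph V} {x y : V} {S : Set V}
    (hS : IsCutset G x y S) (hmin : ∀ T : Set V, T ⊆ S → IsCutset G x y T → T = S)
    {T : Set V} (hT : T ⊆ S) (hne : T ≠ S) : ∃ p : G.Walk x y, ∀ v ∈ p.support, v ∉ T := by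
  by_contra! h
  refine hne (hmin T hT ⟨hT.trans hS.1, fun p => ?_⟩)
  obtain ⟨v, hv, hvT⟩ := h p
  exact ⟨v, hvT, hv⟩

/-- Let `G` be a locally finite graph, `x ≠ y` two vertices, `S` a minimal cutset
between `x` and `y`, and `𝒞` a set of cycles generating the cycle space of `G`
over GF(2). Then for every partition of `S` into two nonempty parts `S₁`, `S₂`,
some cycle of `𝒞` meets both `S₁` and `S₂`. -/
theorem cycle_meets_both_parts_of_min_cutset
    {V : Type} (G : SimpleGraph V)
    (hlf : ∀ v : V, (G.neighborSet v).Finite)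
    (x y : V) (hxy : x ≠ y)
    (S : Set V) (hS : IsCutset G x y S)
    (hmin : ∀ T : Set V, T ⊆ S → IsCutset G x y T → T = S)
    (𝒞 : Set (Σ v : V, G.Walk v v)) (hgen : GeneratesCycleSpace G 𝒞)
    (S₁ S₂ : Set V) (h1 : S₁.Nonempty) (h2 : S₂.Nonempty)
    (hU : S₁ ∪ S₂ = S) (hdisj : Disjoint S₁ S₂) :
    ∃ O ∈ 𝒞, (∃ v ∈ S₁, v ∈ O.2.support) ∧ (∃ v ∈ S₂, v ∈ O.2.support) := by
  classical
  subst hU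
  by_contra! hcon
  obtain ⟨p, hp⟩ := exists_walk_avoiding hS hmin Set.subset_union_left (by
    intro h
    obtain ⟨v, hv⟩ := h2
    exact hdisj.notMem_of_mem_right hv (h ▸ Set.mem_union_right _ hv))
  obtain ⟨q, hq⟩ := exists_walk_avoiding hS hmin Set.subset_union_right (by
    intro h
    obtain ⟨v, hv⟩ := h1
    exact hdisj.notMem_of_mem_left hv (h ▸ Set.mem_union_left _ hv))
  -- `A` is the vertex set of the component of `x` in `G - S`.
  let A : Set V := {v | ∃ w : G.Walk x v, ∀ a ∈ w.support, a ∉ S₁ ∪ S₂}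
  have hxA : x ∈ A := ⟨.nil, fun a ha hmem => by
    rw [SimpleGraph.Walk.support_nil, List.mem_singleton] at ha
    exact hS.1 hmem (Or.inl ha)⟩
  have hyA : y ∉ A := fun ⟨w, hw⟩ => by
    obtain ⟨v, hv, hvw⟩ := hS.2 w
    exact hw v hvw hv
  have hstep : ∀ ⦃a b⦄, G.Adj a b → b ∉ S₁ ∪ S₂ → a ∈ A → b ∈ A := by
    rintro a b hab hb ⟨w, hw⟩
    refine ⟨w.concat hab, fun c hc => ?_⟩
    rw [SimpleGraph.Walk.support_concat, List.mem_append,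
      List.mem_singleton] at hc
    rcases hc with hc | rfl
    · exact hw c hc
    · exact hb
  let g : V → ZMod 2 := fun v => if v ∈ A then 1 else 0
  -- `f` is the indicator of the edges between `A` and `S₁`.
  let f : Sym2 V → ZMod 2 := fun e => if ∃ a ∈ e, a ∈ S₁ then coboundary g e else 0
  have hf₁ : ∀ {u v : V} (w : G.Walk u v), (∀ a ∈ w.support, a ∉ S₁) →
      (w.edges.map f).sum = 0 := by
    intro u v w hw
    refine List.sum_eq_zero fun c hc => ?_
    obtain ⟨e, he, rfl⟩ := List.mem_map.1 hc
    refine if_neg ?_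
    rintro ⟨a, hae, ha⟩
    exact hw a (SimpleGraph.Walk.mem_support_of_mem_edges he hae) ha
  have hf₂ : ∀ {u v : V} (w : G.Walk u v), (∀ a ∈ w.support, a ∉ S₂) →
      (w.edges.map f).sum = g u + g v := by
    intro u v w hw
    rw [← sum_edges_coboundary g w]
    refine congrArg List.sum (List.map_congr_left fun e he => ?_)
    by_cases hmem : ∃ a ∈ e, a ∈ S₁
    · exact if_pos hmem
    · refine (if_neg hmem).trans ?_
      induction e with
      | h a b =>
        have hnot : ∀ c ∈ s(a, b), c ∉ S₁ ∪ S₂ := by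
          rintro c hc (h | h)
          · exact hmem ⟨c, hc, h⟩
          · exact hw c (SimpleGraph.Walk.mem_support_of_mem_edges he hc) h
        have hab : G.Adj a b := w.adj_of_mem_edges he
        have hiff : a ∈ A ↔ b ∈ A :=
          ⟨hstep hab (hnot b (Sym2.mem_mk_right a b)),
            hstep hab.symm (hnot a (Sym2.mem_mk_left a b))⟩
        change 0 = g a + g b
        simp only [g, hiff, CharTwo.add_self_eq_zero]
  have hcycle : ∀ O ∈ 𝒞, (O.2.edges.map f).sum = 0 := by
    intro O hO
    by_cases hO₁ : ∃ v ∈ S₁, v ∈ O.2.support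
    · rw [hf₂ O.2 fun a ha haS => hcon O hO hO₁ a haS ha, CharTwo.add_self_eq_zero]
    · exact hf₁ O.2 fun a ha haS => hO₁ ⟨a, haS, ha⟩
  have hpq := sum_edges_eq_of_cycles f (fun _ W hW => hgen.sum_edges_eq_zero f hcycle W hW) p q
  rw [hf₁ p hp, hf₂ q hq] at hpq
  simp [g, hxA, hyA] at hpq
end

section
/- Let G be a locally finite graph, let x and y be two distinct vertices of G, and let S be a minimal cutset between x and y. Let 𝒞 be a set of cycles of G that generates the cycle space of G over GF(2). Let (S₁,S₂) be a partition of S into two nonempty parts, and let E₂ be the set of edges of G joining a vertex of S₂ to a vertex of the connected component of G∖S containing x. Then there exists a cycle O ∈ 𝒞 whose vertex set intersects S₁ and whose edge set contains an odd number of edges of E₂ (in particular O also intersects S₂). -/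
open Classical in
theorem sum_edgeVec_filter {V : Type} {G : SimpleGraph V} {u : V} {W : G.Walk u u}
    (hW : W.edges.Nodup) (E : Set (Sym2 V)) (F : Finset (Sym2 V)) (hF : W.edges.toFinset ⊆ F) :
    ∑ e ∈ F with e ∈ E, edgeVec G W e = (W.edges.countP fun e => decide (e ∈ E) : ℕ) := by
  have h : (W.edges.countP fun e => decide (e ∈ E)) =
      ((F.filter (· ∈ E)).filter (· ∈ W.edges)).card := by
    rw [List.countP_eq_length_filter, ← List.toFinset_card_of_nodup (hW.filter _)]
    congr 1
    ext e
    simp only [List.mem_toFinset, List.mem_filter, decide_eq_true_eq, Finset.mem_filter]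
    have : e ∈ W.edges → e ∈ F := fun he => hF (List.mem_toFinset.2 he)
    tauto
  rw [h]
  simp [edgeVec, Finset.sum_boole]

open Classical in
/-- If a set of cycles generates the cycle space and some cycle meets the edge set `E` in an odd
number of edges, then so does one of the generators. -/
theorem GeneratesCycleSpace.exists_odd_countP {V : Type} {G : SimpleGraph V}
    {𝒞 : Set (Σ v : V, G.Walk v v)} (hgen : GeneratesCycleSpace G 𝒞) (E : Set (Sym2 V))
    {u : V} {W : G.Walk u u} (hW : W.IsCycle)
    (hodd : Odd (W.edges.countP fun e => decide (e ∈ E))) :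
    ∃ O ∈ 𝒞, Odd (O.2.edges.countP fun e => decide (e ∈ E)) := by
  by_contra! hcon
  obtain ⟨s, hs, hsum⟩ := hgen.2 W hW
  let F : Finset (Sym2 V) := W.edges.toFinset ∪ s.biUnion fun O => O.2.edges.toFinset
  have hzero : ∑ e ∈ F with e ∈ E, edgeVec G W e = 0 := by
    simp_rw [hsum]
    rw [Finset.sum_comm]
    refine Finset.sum_eq_zero fun O hO => ?_
    rw [sum_edgeVec_filter (hgen.1 O (hs hO)).edges_nodup E F]
    · exact ZMod.natCast_eq_zero_iff_even.2 (Nat.not_odd_iff_even.1 (hcon O (hs hO)))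
    · exact (Finset.subset_biUnion_of_mem (fun O : Σ v : V, G.Walk v v => O.2.edges.toFinset)
        hO).trans Finset.subset_union_right
  rw [sum_edgeVec_filter hW.edges_nodup E F Finset.subset_union_left,
    ZMod.natCast_eq_zero_iff_even] at hzero
  exact Nat.not_even_iff_odd.2 hodd hzero

open Classical in
/-- If, along a walk, the edges of `E` are exactly those with one end in `C`, then the walk uses an
even number of them if and only if `C` contains both or none of its ends. -/
theorem SimpleGraph.Walk.even_countP_iff {V : Type} {G : SimpleGraph V} {C : Set V}
    {E : Set (Sym2 V)} {u v : V} (p : G.Walk u v)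
    (hE : ∀ a b : V, a ∈ p.support → b ∈ p.support → G.Adj a b →
      (s(a, b) ∈ E ↔ ¬(a ∈ C ↔ b ∈ C))) :
    Even (p.edges.countP fun e => decide (e ∈ E)) ↔ (u ∈ C ↔ v ∈ C) := by
  induction p with
  | nil => simp
  | @cons a b c h q ih =>
    have hq := ih fun a b ha hb => hE a b (by simp [ha]) (by simp [hb])
    have hab := hE a b (by simp) (by simp) h
    rw [SimpleGraph.Walk.edges_cons, List.countP_cons]
    by_cases he : s(a, b) ∈ E
    · simp only [he, decide_true, if_true, Nat.even_add_one, hq]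
      tauto
    · simp only [he, decide_false, Bool.false_eq_true, if_false, add_zero, hq]
      tauto

open Classical in
/-- If the ends of an edge `s(a, b)` of `E` remain connected after deleting `E`, then some cycle
has `s(a, b)` as its only edge in `E`. -/
theorem SimpleGraph.exists_isCycle_odd_countP {V : Type} {G : SimpleGraph V} {E : Set (Sym2 V)}
    {a b : V} (hab : G.Adj a b) (hE : s(a, b) ∈ E) (hr : (G.deleteEdges E).Reachable a b) :
    ∃ (u : V) (W : G.Walk u u), W.IsCycle ∧ Odd (W.edges.countP fun e => decide (e ∈ E)) := by
  let H := G.deleteEdges (E \ {s(a, b)})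
  have hH : H.Adj a b := by simp [H, hab]
  have hle : G.deleteEdges E ≤ H \ fromEdgeSet {s(a, b)} := by
    intro c d hcd
    simp only [H, deleteEdges_adj, sdiff_adj, fromEdgeSet_adj, Set.mem_sdiff,
      Set.mem_singleton_iff] at hcd ⊢
    refine ⟨⟨hcd.1, fun h => hcd.2 h.1⟩, fun h => hcd.2 (h.1 ▸ hE)⟩
  obtain ⟨u, p, hp, hmem⟩ :=
    adj_and_reachable_delete_edges_iff_exists_cycle.1 ⟨hH, hr.mono hle⟩
  refine ⟨u, p.mapLe (deleteEdges_le _), hp.mapLe _, ?_⟩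
  have hcount : (p.edges.countP fun e => decide (e ∈ E)) = p.edges.count s(a, b) := by
    refine List.countP_congr fun e he => ?_
    have := p.edges_subset_edgeSet he
    simp only [H, edgeSet_deleteEdges, Set.mem_sdiff, Set.mem_singleton_iff] at this
    simp only [decide_eq_true_eq, beq_iff_eq]
    exact ⟨fun h => by tauto, fun h => h ▸ hE⟩
  rw [Walk.edges_mapLe_eq_edges, hcount, List.count_eq_one_of_mem hp.edges_nodup hmem]
  exact odd_one

/-- For each vertex `s` of a minimal cutset, some walk meets the cutset in `s` only. -/
theorem IsCutset.exists_walk_of_mem {V : Type} {G : SimpleGraph V} {x y : V} {S : Set V}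
    (hS : IsCutset G x y S) (hmin : ∀ T : Set V, T ⊆ S → IsCutset G x y T → T = S)
    {s : V} (hs : s ∈ S) :
    ∃ p : G.Walk x y, s ∈ p.support ∧ ∀ v ∈ p.support, v ∈ S → v = s := by
  have hnot : ¬IsCutset G x y (S \ {s}) := fun h =>
    ((hmin _ Set.sdiff_subset h).symm.subset hs).2 rfl
  have : ∃ p : G.Walk x y, ∀ v ∈ S \ {s}, v ∉ p.support := by
    by_contra! h
    exact hnot ⟨Set.sdiff_subset.trans hS.1, h⟩
  obtain ⟨p, hp⟩ := this
  have honly : ∀ v ∈ p.support, v ∈ S → v = s := fun v hv hvS => by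
    by_contra hne
    exact hp v ⟨hvS, hne⟩ hv
  obtain ⟨v, hvS, hv⟩ := hS.2 p
  exact ⟨p, honly v hv hvS ▸ hv, honly⟩

/-- If a walk to `y` meets `S` in `s` only and `K` contains the edges of `G` outside `S` and the
edges from `s` to vertices joined to `y` outside `S`, then `s` is joined to `y` in `K`. -/
theorem SimpleGraph.Walk.reachable_of_mem_support {V : Type} {G K : SimpleGraph V} {S : Set V}
    {s u y : V} (hy : y ≠ s)
    (hK : ∀ ⦃a b : V⦄ (q : G.Walk a b), (∀ v ∈ q.support, v ∉ S) → K.Reachable a b)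
    (hsK : ∀ ⦃b : V⦄ (q : G.Walk b y), (∀ v ∈ q.support, v ∉ S) → G.Adj s b → K.Adj s b)
    (p : G.Walk u y) (hsp : s ∈ p.support) (hp : ∀ v ∈ p.support, v ∈ S → v = s) :
    K.Reachable s y := by
  induction p with
  | nil => simp_all
  | @cons a b c h q ih =>
    by_cases hsq : s ∈ q.support
    · exact ih hy hsK hsq fun v hv => hp v (by simp [hv])
    · obtain rfl : s = a := by simpa [hsq] using hsp
      have hq : ∀ v ∈ q.support, v ∉ S := fun v hv hvS =>
        hsq (hp v (by simp [hv]) hvS ▸ hv)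
      exact (hsK q hq h).reachable.trans (hK q hq)

open Classical in
/-- Let `G` be a locally finite graph, `x ≠ y` two vertices, `S` a minimal
cutset between `x` and `y`, and `𝒞` a set of cycles generating the cycle space
of `G` over GF(2).  Let `(S₁, S₂)` be a partition of `S` into nonempty parts,
and let `E₂` be the set of edges of `G` joining a vertex of `S₂` to a vertex of
the connected component of `G ∖ S` containing `x`.  Then some cycle `O ∈ 𝒞`
meets `S₁` and contains an odd number of edges of `E₂`. -/
theorem cycle_meets_part_with_odd_boundary_edges
    {V : Type} (G : SimpleGraph V)
    (hlf : ∀ v : V, (G.neighborSet v).Finite)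
    (x y : V) (hxy : x ≠ y)
    (S : Set V) (hS : IsCutset G x y S)
    (hmin : ∀ T : Set V, T ⊆ S → IsCutset G x y T → T = S)
    (𝒞 : Set (Σ v : V, G.Walk v v)) (hgen : GeneratesCycleSpace G 𝒞)
    (S₁ S₂ : Set V) (h1 : S₁.Nonempty) (h2 : S₂.Nonempty)
    (hU : S₁ ∪ S₂ = S) (hdisj : Disjoint S₁ S₂)
    -- the component of `x` in the subgraph of `G` induced on `V ∖ S`:
    (compx : Set V)
    (hcompx : compx = {u : V | ∃ p : G.Walk x u, ∀ v ∈ p.support, v ∉ S})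
    -- the edges joining `S₂` to that component:
    (E₂ : Set (Sym2 V))
    (hE₂ : E₂ = {e : Sym2 V | ∃ u v : V, G.Adj u v ∧ u ∈ S₂ ∧ v ∈ compx ∧ e = s(u, v)}) :
    ∃ O ∈ 𝒞, (∃ v ∈ S₁, v ∈ O.2.support) ∧
      Odd (O.2.edges.countP fun e => decide (e ∈ E₂)) := by
  have hC : ∀ u v, u ∈ compx → G.Adj u v → v ∉ S → v ∈ compx := by
    subst hcompx
    rintro u v ⟨p, hp⟩ huv hv
    refine ⟨p.concat huv, fun w hw => ?_⟩
    rw [SimpleGraph.Walk.support_concat, List.mem_append, List.mem_singleton] at hw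
    rcases hw with hw | rfl
    exacts [hp w hw, hv]
  have hCS : ∀ u ∈ compx, u ∉ S := by
    subst hcompx
    rintro u ⟨p, hp⟩
    exact hp u p.end_mem_support
  have hxS : x ∉ S := fun h => hS.1 h (by simp)
  have hyS : y ∉ S := fun h => hS.1 h (by simp)
  have hxC : x ∈ compx := by
    subst hcompx
    exact ⟨.nil, by simpa using hxS⟩
  have hyC : ∀ ⦃b : V⦄ (q : G.Walk b y), (∀ v ∈ q.support, v ∉ S) → b ∉ compx := by
    subst hcompx
    rintro b q hq ⟨p, hp⟩
    obtain ⟨v, hvS, hv⟩ := hS.2 (p.append q)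
    rcases SimpleGraph.Walk.mem_support_append_iff _ _ |>.1 hv with hv | hv
    exacts [hp v hv hvS, hq v hv hvS]
  have hS₁ : ∀ v ∈ S₁, v ∈ S := fun v hv => hU ▸ Or.inl hv
  have hS₂ : ∀ v ∈ S₂, v ∈ S := fun v hv => hU ▸ Or.inr hv
  have hmemE : ∀ a b, G.Adj a b →
      (s(a, b) ∈ E₂ ↔ (a ∈ S₂ ∧ b ∈ compx) ∨ (b ∈ S₂ ∧ a ∈ compx)) := by
    subst hE₂
    refine fun a b hab => ⟨?_, ?_⟩
    · rintro ⟨u, v, -, hu, hv, he⟩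
      rcases Sym2.eq_iff.1 he with ⟨rfl, rfl⟩ | ⟨rfl, rfl⟩
      exacts [Or.inl ⟨hu, hv⟩, Or.inr ⟨hu, hv⟩]
    · rintro (⟨ha, hb⟩ | ⟨hb, ha⟩)
      exacts [⟨a, b, hab, ha, hb, rfl⟩, ⟨b, a, hab.symm, hb, ha, Sym2.eq_swap⟩]
  have hreach : ∀ ⦃a b : V⦄ (q : G.Walk a b), (∀ v ∈ q.support, v ∉ S₂) →
      (G.deleteEdges E₂).Reachable a b := by
    refine fun a b q hq => ⟨q.toDeleteEdges E₂ fun e he heE => ?_⟩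
    subst hE₂
    obtain ⟨u, v, -, hu, -, rfl⟩ := heE
    exact hq u (q.fst_mem_support_of_mem_edges he) hu
  obtain ⟨s₁, hs₁⟩ := h1
  obtain ⟨s₂, hs₂⟩ := h2
  obtain ⟨p₁, -, hp₁⟩ := hS.exists_walk_of_mem hmin (hS₁ s₁ hs₁)
  obtain ⟨p₂, hsp₂, hp₂⟩ := hS.exists_walk_of_mem hmin (hS₂ s₂ hs₂)
  obtain ⟨v, hv, hadj⟩ : ∃ v ∈ compx, G.Adj s₂ v := by
    obtain ⟨d, hd, hd₁, hd₂⟩ := p₂.exists_boundary_dart compx hxC (hyC .nil (by simpa using hyS))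
    have hdS : d.snd ∈ S := by
      by_contra h
      exact hd₂ (hC _ _ hd₁ d.adj h)
    exact ⟨d.fst, hd₁, hp₂ _ (p₂.dart_snd_mem_support_of_mem_darts hd) hdS ▸ d.adj.symm⟩
  have hs₂y : (G.deleteEdges E₂).Reachable s₂ y := by
    refine p₂.reachable_of_mem_support (S := S) (fun h => hyS (h ▸ hS₂ s₂ hs₂))
      (fun a b q hq => hreach q fun v hv h => hq v hv (hS₂ v h)) (fun b q hq hb => ?_) hsp₂ hp₂
    refine G.deleteEdges_adj.2 ⟨hb, fun h => ?_⟩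
    rcases (hmemE _ _ hb).1 h with h | h
    exacts [hyC q hq h.2, hq b q.start_mem_support (hS₂ b h.1)]
  have hxy' : (G.deleteEdges E₂).Reachable x y := hreach p₁ fun v hv h =>
    Set.disjoint_left.1 hdisj hs₁ (hp₁ v hv (hS₂ v h) ▸ h)
  have hxv : (G.deleteEdges E₂).Reachable x v := by
    subst hcompx
    obtain ⟨p, hp⟩ := hv
    exact hreach p fun w hw h => hp w hw (hS₂ w h)
  obtain ⟨u, W, hW, hodd⟩ := SimpleGraph.exists_isCycle_odd_countP hadj
    ((hmemE _ _ hadj).2 (Or.inl ⟨hs₂, hv⟩)) (hs₂y.trans (hxy'.symm.trans hxv))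
  obtain ⟨O, hO, hOodd⟩ := hgen.exists_odd_countP E₂ hW hodd
  refine ⟨O, hO, ?_, hOodd⟩
  by_contra! hO₁
  refine Nat.not_even_iff_odd.2 hOodd ((O.2.even_countP_iff (C := compx) ?_).2 Iff.rfl)
  intro a b ha hb hab
  have hSmem : ∀ w, w ∈ S ↔ w ∈ S₁ ∨ w ∈ S₂ := fun w => by rw [← hU]; rfl
  have ha₁ : a ∉ S₁ := fun h => hO₁ a h ha
  have hb₁ : b ∉ S₁ := fun h => hO₁ b h hb
  have := hC a b
  have := hC b a
  have := hCS a
  have := hCS b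
  have := hab.symm
  rw [hmemE a b hab]
  grind
end

section
/- Let G be a locally finite connected graph, let C be a nonempty connected set of vertices of G, and let x be a vertex of G with x ∉ C and x not adjacent to any vertex of C. Then S := ∂_{outvis(x)}(C) is a minimal cutset between x and C: every path in G from x to a vertex of C meets S, and for every y ∈ S there is a path in G from x to a vertex of C that meets S only in y. -/
/-- The outer boundary of `C` visible from `x`: vertices adjacent to `C` that
can be reached from `x` by a walk disjoint from `C`. -/
def visBoundary {V : Type} (G : SimpleGraph V) (C : Set V) (x : V) : Set V :=
  {y | (∃ c ∈ C, G.Adj y c) ∧ ∃ p : G.Walk x y, ∀ v ∈ p.support, v ∉ C}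

/-- The outer visible boundary of `C` from `x`: vertices of the visible
boundary reachable from `x` by a walk with no interior vertex in the visible
boundary. -/
def outvisBoundary {V : Type} (G : SimpleGraph V) (C : Set V) (x : V) : Set V :=
  {y ∈ visBoundary G C x |
    ∃ p : G.Walk x y, ∀ v ∈ p.support, v ≠ x → v ≠ y → v ∉ visBoundary G C x}

namespace SimpleGraph.Walk

variable {V : Type*} {G : SimpleGraph V}

/-- A walk meeting `S` contains a walk from the same start that meets `S` exactly at its end. -/
theorem exists_walk_first_mem (S : Set V) {x z : V} (p : G.Walk x z)
    (h : ∃ v ∈ p.support, v ∈ S) :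
    ∃ y ∈ S, ∃ q : G.Walk x y, q.support ⊆ p.support ∧ ∀ v ∈ q.support, v ∈ S → v = y := by
  induction p with
  | nil =>
    obtain ⟨v, hv, hvS⟩ := h
    obtain rfl := by simpa using hv
    exact ⟨v, hvS, nil, by simp, by simp⟩
  | @cons u w z huw p ih =>
    by_cases hu : u ∈ S
    · exact ⟨u, hu, nil, by simp, by simp⟩
    · have h' : ∃ v ∈ p.support, v ∈ S := by
        obtain ⟨v, hv, hvS⟩ := h
        rw [support_cons, List.mem_cons] at hv
        rcases hv with rfl | hv
        · exact absurd hvS hu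
        · exact ⟨v, hv, hvS⟩
      obtain ⟨y, hy, q, hq, hqS⟩ := ih h'
      refine ⟨y, hy, cons huw q, ?_, ?_⟩
      · simpa using List.subset_cons_of_subset u hq
      · intro v hv hvS
        rw [support_cons, List.mem_cons] at hv
        rcases hv with rfl | hv
        · exact absurd hvS hu
        · exact hqS v hv hvS

/-- A walk from outside `C` into `C` contains a walk from the same start that avoids `C` and ends
at a neighbour of `C`. -/
theorem exists_walk_disjoint_adj (C : Set V) {x c : V} (p : G.Walk x c) (hx : x ∉ C)
    (hc : c ∈ C) :
    ∃ y, (∃ d ∈ C, G.Adj y d) ∧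
      ∃ q : G.Walk x y, q.support ⊆ p.support ∧ ∀ v ∈ q.support, v ∉ C := by
  induction p with
  | nil => exact absurd hc hx
  | @cons u w z huw p ih =>
    by_cases hw : w ∈ C
    · exact ⟨u, ⟨w, hw, huw⟩, nil, by simp, by simpa using hx⟩
    · obtain ⟨y, hy, q, hq, hqC⟩ := ih hw hc
      refine ⟨y, hy, cons huw q, ?_, ?_⟩
      · simpa using List.subset_cons_of_subset u hq
      · simpa using ⟨hx, hqC⟩

end SimpleGraph.Walk

/-- Let `G` be a locally finite connected graph, `C` a nonempty connected set of
vertices, and `x ∉ C` a vertex not adjacent to any vertex of `C`.  Then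
`S := ∂_{outvis(x)}(C)` is a minimal cutset between `x` and `C`: every walk from
`x` to a vertex of `C` meets `S`, and for every `y ∈ S` there is a walk from `x`
to a vertex of `C` meeting `S` only in `y`. -/
theorem outvisBoundary_isMinimalCutset
    {V : Type} (G : SimpleGraph V)
    (hconn : G.Connected)
    (hlf : ∀ v : V, (G.neighborSet v).Finite)
    (C : Set V) (hCne : C.Nonempty) (hCconn : (G.induce C).Connected)
    (x : V) (hx : x ∉ C) (hxadj : ¬ ∃ c ∈ C, G.Adj x c) :
    (∀ c ∈ C, ∀ p : G.Walk x c, ∃ v ∈ outvisBoundary G C x, v ∈ p.support) ∧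
      ∀ y ∈ outvisBoundary G C x, ∃ c ∈ C, ∃ p : G.Walk x c,
        ∀ v ∈ outvisBoundary G C x, v ∈ p.support → v = y := by
  constructor
  · intro c hc p
    obtain ⟨y, hy, q, hqp, hqC⟩ := p.exists_walk_disjoint_adj C hx hc
    obtain ⟨z, hz, r, hrq, hr⟩ := q.exists_walk_first_mem (visBoundary G C x)
      ⟨y, q.end_mem_support, hy, q, hqC⟩
    exact ⟨z, ⟨hz, r, fun v hv _ hvz hvis ↦ hvz (hr v hv hvis)⟩, hqp (hrq r.end_mem_support)⟩
  · rintro y ⟨⟨⟨c, hc, hyc⟩, -⟩, p, hp⟩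
    refine ⟨c, hc, p.concat hyc, fun v hv hvp ↦ ?_⟩
    rw [SimpleGraph.Walk.support_concat, List.mem_append, List.mem_singleton] at hvp
    rcases hvp with hvp | rfl
    · by_contra hvy
      refine hp v hvp ?_ hvy hv.1
      rintro rfl
      exact hxadj hv.1.1
    · obtain ⟨-, q, hq⟩ := hv.1
      exact absurd hc (hq v q.end_mem_support)
end

section
/- Let G be a locally finite connected graph and G⁺ a graph on the same vertex set containing every edge of G. Suppose there is a set 𝒞 of cycles of G that generates the cycle space of G over GF(2) and such that every cycle in 𝒞 is chordal in G⁺. Then for every nonempty connected set of vertices C of G and every vertex x ∉ C, the set ∂_{vis(x)}(C) is connected in G⁺, that is, it induces a connected subgraph of G⁺. -/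
/-- The GF(2)-sum of an edge labelling over the edges traversed by a walk, for the labelling that
marks the edges lying in `S`. -/
noncomputable def walkParity {V : Type} {G : SimpleGraph V} (S : Set (Sym2 V)) {u v : V}
    (W : G.Walk u v) : ZMod 2 :=
  (W.edges.map (S.indicator 1)).sum

theorem walkParity_cons {V : Type} {G : SimpleGraph V} (S : Set (Sym2 V)) {u v w : V}
    (h : G.Adj u v) (W : G.Walk v w) :
    walkParity S (SimpleGraph.Walk.cons h W) = S.indicator 1 s(u, v) + walkParity S W := by
  simp [walkParity]

theorem walkParity_append {V : Type} {G : SimpleGraph V} (S : Set (Sym2 V)) {u v w : V}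
    (W : G.Walk u v) (W' : G.Walk v w) :
    walkParity S (W.append W') = walkParity S W + walkParity S W' := by
  simp [walkParity]

theorem walkParity_congr {V : Type} {G : SimpleGraph V} {S T : Set (Sym2 V)} {u v : V}
    (W : G.Walk u v) (h : ∀ e ∈ W.edges, (e ∈ S ↔ e ∈ T)) :
    walkParity S W = walkParity T W := by
  classical
  unfold walkParity
  congr 1
  refine List.map_congr_left fun e he => ?_
  simp [Set.indicator_apply, h e he]

theorem walkParity_eq_zero {V : Type} {G : SimpleGraph V} {S : Set (Sym2 V)} {u v : V}
    (W : G.Walk u v) (h : ∀ e ∈ W.edges, e ∉ S) : walkParity S W = 0 := by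
  rw [walkParity_congr (T := ∅) W (by simpa using h)]
  simp [walkParity]

/-- The set of pairs joining a vertex of `A` to a vertex of `B`. -/
def crossingPairs {V : Type} (A B : Set V) : Set (Sym2 V) :=
  {e | ∃ a ∈ A, ∃ b ∈ B, e = s(a, b)}

theorem mk_mem_crossingPairs {V : Type} {A B : Set V} {u v : V} :
    s(u, v) ∈ crossingPairs A B ↔ (u ∈ A ∧ v ∈ B) ∨ (v ∈ A ∧ u ∈ B) := by
  simp only [crossingPairs, Set.mem_ofPred_eq, Sym2.eq_iff]
  grind

/-- The parity of the number of crossings of a cut only depends on the ends of a walk. -/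
theorem walkParity_cut {V : Type} {G : SimpleGraph V} (D : Set V) {u v : V} (W : G.Walk u v) :
    walkParity (crossingPairs Dᶜ D) W = D.indicator 1 u + D.indicator 1 v := by
  classical
  induction W with
  | nil => simp [walkParity, CharTwo.add_self_eq_zero]
  | @cons u v w h W ih =>
    rw [walkParity_cons, ih]
    have h2 : (1 : ZMod 2) + 1 = 0 := rfl
    by_cases hu : u ∈ D <;> by_cases hv : v ∈ D <;> by_cases hw : w ∈ D <;>
      simp [mk_mem_crossingPairs, hu, hv, hw, h2]

theorem walkParity_cut_closed {V : Type} {G : SimpleGraph V} (D : Set V) {u : V}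
    (W : G.Walk u u) : walkParity (crossingPairs Dᶜ D) W = 0 := by
  rw [walkParity_cut, CharTwo.add_self_eq_zero]

theorem walkParity_eq_sum_edgeVec {V : Type} {G : SimpleGraph V} (S : Set (Sym2 V)) {u : V}
    {W : G.Walk u u} (hW : W.IsCycle) {F : Finset (Sym2 V)} (hF : ∀ e ∈ W.edges, e ∈ F) :
    walkParity S W = ∑ e ∈ F, edgeVec G W e * S.indicator 1 e := by
  classical
  unfold walkParity
  rw [← List.sum_toFinset _ hW.edges_nodup]
  have hsub : W.edges.toFinset ⊆ F := fun e he => hF e (by simpa using he)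
  rw [← Finset.sum_subset hsub (by intro e _ he; simp_all [edgeVec])]
  refine Finset.sum_congr rfl fun e he => ?_
  simp_all [edgeVec]

/-- A parity that vanishes on a generating set of cycles vanishes on every cycle. -/
theorem GeneratesCycleSpace.walkParity_eq_zero {V : Type} {G : SimpleGraph V}
    {𝒞 : Set (Σ v : V, G.Walk v v)} (hgen : GeneratesCycleSpace G 𝒞) {S : Set (Sym2 V)}
    (hS : ∀ O ∈ 𝒞, walkParity S O.2 = 0) {u : V} {W : G.Walk u u} (hW : W.IsCycle) :
    walkParity S W = 0 := by
  classical
  obtain ⟨s, hs, hsum⟩ := hgen.2 W hW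
  let F : Finset (Sym2 V) := W.edges.toFinset ∪ s.biUnion fun O => O.2.edges.toFinset
  rw [walkParity_eq_sum_edgeVec S hW (F := F) (fun e he => by simp [F, he])]
  simp_rw [hsum, Finset.sum_mul]
  rw [Finset.sum_comm]
  refine Finset.sum_eq_zero fun O hO => ?_
  rw [← walkParity_eq_sum_edgeVec S (hgen.1 O (hs hO)), hS O (hs hO)]
  intro e he
  simp only [F, Finset.mem_union, Finset.mem_biUnion, List.mem_toFinset]
  exact Or.inr ⟨O, hO, he⟩

theorem visBoundary_nonempty {V : Type} {G : SimpleGraph V} {C : Set V} {x c : V}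
    (W : G.Walk x c) (hx : x ∉ C) (hc : c ∈ C) : (visBoundary G C x).Nonempty := by
  induction W with
  | nil => exact absurd hc hx
  | @cons x v c h W ih =>
    by_cases hv : v ∈ C
    · exact ⟨x, ⟨v, hv, h⟩, SimpleGraph.Walk.nil, by simpa using hx⟩
    · obtain ⟨y, hy, p, hp⟩ := ih hv hc
      exact ⟨y, hy, SimpleGraph.Walk.cons h p, by simpa using ⟨hx, hp⟩⟩

theorem exists_isPath_of_induce_connected {V : Type} {G : SimpleGraph V} {C : Set V}
    (hC : (G.induce C).Connected) {c d : V} (hc : c ∈ C) (hd : d ∈ C) :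
    ∃ q : G.Walk c d, q.IsPath ∧ ∀ v ∈ q.support, v ∈ C := by
  classical
  obtain ⟨q⟩ := hC.preconnected ⟨c, hc⟩ ⟨d, hd⟩
  let f : G.induce C →g G := (SimpleGraph.Embedding.induce C).toHom
  have hsupp : ∀ v ∈ (q.map f).support, v ∈ C := by
    intro v hv
    rw [SimpleGraph.Walk.support_map, List.mem_map] at hv
    obtain ⟨w, -, rfl⟩ := hv
    exact w.2
  exact ⟨(q.map f).bypass, (q.map f).bypass_isPath,
    fun v hv => hsupp v ((q.map f).support_bypass_subset_support hv)⟩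

/-- Two edges between disjoint paths close up to a cycle. -/
theorem isCycle_of_disjoint_paths {V : Type} {G : SimpleGraph V} {a b c d : V}
    {p : G.Walk a b} {q : G.Walk c d} (hp : p.IsPath) (hq : q.IsPath)
    (hdisj : p.support.Disjoint q.support) (hab : a ≠ b) (hbc : G.Adj b c) (hda : G.Adj d a) :
    (SimpleGraph.Walk.cons hda (p.append (SimpleGraph.Walk.cons hbc q))).IsCycle := by
  rw [SimpleGraph.Walk.cons_isCycle_iff]
  constructor
  · rw [SimpleGraph.Walk.isPath_def, SimpleGraph.Walk.support_append]
    simpa using List.nodup_append'.2 ⟨hp.support_nodup, hq.support_nodup, hdisj⟩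
  · have hd : d ∉ p.support := fun h => hdisj h q.end_mem_support
    have ha : a ∉ q.support := hdisj p.start_mem_support
    simp only [SimpleGraph.Walk.edges_append, SimpleGraph.Walk.edges_cons, List.mem_append,
      List.mem_cons, Sym2.eq_iff, not_or]
    refine ⟨fun h => hd (p.fst_mem_support_of_mem_edges h), ⟨?_, ?_⟩,
      fun h => ha (q.snd_mem_support_of_mem_edges h)⟩
    · rintro ⟨rfl, -⟩
      exact hd p.end_mem_support
    · rintro ⟨-, rfl⟩
      exact hab rfl

/-- Generalized Deuschel–Pisztora theorem.  Let `G` be a locally finite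
connected graph and `Gp ⊇ G` a graph on the same vertex set.  Suppose some set
`𝒞` of cycles generates the cycle space of `G` over GF(2) and every cycle of
`𝒞` is chordal in `Gp` (any two distinct vertices on it are `Gp`-adjacent).
Then for every nonempty connected set of vertices `C` of `G` and every vertex
`x ∉ C`, the visible boundary `∂_{vis(x)}(C)` induces a connected subgraph of
`Gp`. -/
theorem visBoundary_connected_in_supergraph
    {V : Type} (G Gp : SimpleGraph V) (hle : G ≤ Gp)
    (hconn : G.Connected)
    (hlf : ∀ v : V, (G.neighborSet v).Finite)
    (𝒞 : Set (Σ v : V, G.Walk v v)) (hgen : GeneratesCycleSpace G 𝒞)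
    (hchordal : ∀ O ∈ 𝒞, ∀ a ∈ O.2.support, ∀ b ∈ O.2.support, a ≠ b → Gp.Adj a b)
    (C : Set V) (hCne : C.Nonempty) (hCconn : (G.induce C).Connected)
    (x : V) (hx : x ∉ C) :
    (Gp.induce (visBoundary G C x)).Connected := by
  classical
  obtain ⟨c₀, hc₀⟩ := hCne
  obtain ⟨W₀⟩ := hconn.preconnected x c₀
  have : Nonempty (visBoundary G C x) := (visBoundary_nonempty W₀ hx hc₀).to_subtype
  refine ⟨?_⟩
  rintro ⟨a, ha⟩ ⟨b, hb⟩
  by_contra hnot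
  let B₁ : Set V := {y | ∃ hy : y ∈ visBoundary G C x,
    (Gp.induce (visBoundary G C x)).Reachable ⟨a, ha⟩ ⟨y, hy⟩}
  let D : Set V := {y | ∃ p : G.Walk x y, ∀ v ∈ p.support, v ∉ C}
  have haB₁ : a ∈ B₁ := ⟨ha, .rfl⟩
  have hbB₁ : b ∉ B₁ := fun ⟨_, h⟩ => hnot h
  have hDC : ∀ {y}, y ∈ D → y ∉ C := fun ⟨p, hp⟩ => hp _ p.end_mem_support
  have hB₁D : B₁ ⊆ D := fun y hy => hy.1.2
  have hDext : ∀ {u v}, G.Adj u v → u ∈ D → v ∉ D → v ∈ C := by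
    rintro u v huv ⟨p, hp⟩ hv
    by_contra hvC
    refine hv ⟨p.concat huv, fun w hw => ?_⟩
    rw [SimpleGraph.Walk.support_concat, List.mem_append,
      List.mem_singleton] at hw
    rcases hw with hw | rfl
    exacts [hp w hw, hvC]
  have hclosed : ∀ {z u}, z ∈ B₁ → u ∈ visBoundary G C x → (z ≠ u → Gp.Adj z u) → u ∈ B₁ := by
    rintro z u ⟨hz, hr⟩ hu hadj
    by_cases h : z = u
    · subst h; exact ⟨hz, hr⟩
    · refine ⟨hu, hr.trans (SimpleGraph.Adj.reachable ?_)⟩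
      exact hadj h
  have hzero : ∀ O ∈ 𝒞, walkParity (crossingPairs C B₁) O.2 = 0 := by
    intro O hO
    by_cases hz : ∃ z ∈ O.2.support, z ∈ B₁
    · obtain ⟨z, hzO, hz⟩ := hz
      rw [← walkParity_cut_closed D O.2]
      have key : ∀ {u v}, G.Adj u v → u ∈ O.2.support → u ∈ D → v ∉ D → v ∈ C ∧ u ∈ B₁ :=
        fun huv hu huD hvD =>
          have hv := hDext huv huD hvD
          ⟨hv, hclosed hz ⟨⟨_, hv, huv⟩, huD⟩ (hchordal O hO z hzO _ hu)⟩
      refine walkParity_congr _ fun e he => ?_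
      induction e with
      | _ u v =>
        have huv := O.2.adj_of_mem_edges he
        have hu := O.2.fst_mem_support_of_mem_edges he
        have hv := O.2.snd_mem_support_of_mem_edges he
        simp only [mk_mem_crossingPairs, Set.mem_compl_iff]
        constructor
        · rintro (⟨h, h'⟩ | ⟨h, h'⟩)
          exacts [Or.inl ⟨fun hD => hDC hD h, hB₁D h'⟩, Or.inr ⟨fun hD => hDC hD h, hB₁D h'⟩]
        · rintro (⟨h, h'⟩ | ⟨h, h'⟩)
          exacts [Or.inl (key huv.symm hv h' h), Or.inr (key huv hu h' h)]
    · refine walkParity_eq_zero _ fun e he => ?_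
      rintro ⟨c, -, y, hy, rfl⟩
      exact hz ⟨y, O.2.snd_mem_support_of_mem_edges he, hy⟩
  obtain ⟨⟨ca, hca, haca⟩, pa, hpa⟩ := id ha
  obtain ⟨⟨cb, hcb, hbcb⟩, pb, hpb⟩ := id hb
  obtain ⟨p, hpPath, hp⟩ : ∃ p : G.Walk a b, p.IsPath ∧ ∀ v ∈ p.support, v ∉ C := by
    refine ⟨_, (pa.reverse.append pb).bypass_isPath, fun v hv => ?_⟩
    have := SimpleGraph.Walk.support_bypass_subset_support _ hv
    rw [SimpleGraph.Walk.mem_support_append_iff, SimpleGraph.Walk.support_reverse,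
      List.mem_reverse] at this
    exact this.elim (hpa v) (hpb v)
  obtain ⟨q, hqPath, hq⟩ := exists_isPath_of_induce_connected hCconn hcb hca
  have hab : a ≠ b := by
    rintro rfl
    exact hbB₁ haB₁
  have hcyc := isCycle_of_disjoint_paths hpPath hqPath (fun v h h' => hp v h (hq v h'))
    hab hbcb haca.symm
  have h0 := hgen.walkParity_eq_zero hzero hcyc
  have hp0 : walkParity (crossingPairs C B₁) p = 0 := by
    refine walkParity_eq_zero _ fun e he => ?_
    rintro ⟨c, hc, y, -, rfl⟩
    exact hp c (p.fst_mem_support_of_mem_edges he) hc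
  have hq0 : walkParity (crossingPairs C B₁) q = 0 := by
    refine walkParity_eq_zero _ fun e he => ?_
    rintro ⟨c, -, y, hy, rfl⟩
    exact hDC (hB₁D hy) (hq y (q.snd_mem_support_of_mem_edges he))
  have hb0 : s(b, cb) ∉ crossingPairs C B₁ := by
    rw [mk_mem_crossingPairs]
    rintro (⟨-, h⟩ | ⟨-, h⟩)
    exacts [hDC (hB₁D h) hcb, hbB₁ h]
  have ha1 : s(ca, a) ∈ crossingPairs C B₁ := mk_mem_crossingPairs.2 (Or.inl ⟨hca, haB₁⟩)
  rw [walkParity_cons, walkParity_append, walkParity_cons, hp0, hq0,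
    Set.indicator_of_mem ha1, Set.indicator_of_notMem hb0] at h0
  simp at h0
end

section
/- Let G⁺ be a locally finite connected graph and G a connected spanning subgraph of G⁺ (same vertex set, every edge of G an edge of G⁺). Suppose there is a set 𝒞_G of cycles of G generating the cycle space of G over GF(2) such that every cycle in 𝒞_G is chordal in G⁺, and suppose that for every edge e of G⁺ there is a cycle O_e of G⁺ containing e, all of whose edges other than e are edges of G, with O_e chordal in G⁺. Then for every nonempty connected set of vertices C of G⁺ and every vertex x ∉ C, the set ∂^{G⁺}_{vis_G(x)}(C) is connected in G, that is, it induces a connected subgraph of G. -/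
/-- `∂^{G⁺}_{vis_G(x)}(C)`: vertices `Gp`-adjacent to `C` that can be reached
from `x` by a `G`-walk disjoint from `C`. -/
def visBoundary2 {V : Type} (G Gp : SimpleGraph V) (C : Set V) (x : V) : Set V :=
  {y | (∃ c ∈ C, Gp.Adj y c) ∧ ∃ p : G.Walk x y, ∀ v ∈ p.support, v ∉ C}

namespace SimpleGraph.Walk

variable {V : Type}

/-- The sum along a walk of a GF(2)-valued weight on unordered pairs of vertices. -/
def weight {G : SimpleGraph V} (χ : Sym2 V → ZMod 2) {u v : V} (p : G.Walk u v) : ZMod 2 :=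
  (p.edges.map χ).sum

section

variable {G : SimpleGraph V} {χ : Sym2 V → ZMod 2}

@[simp] lemma weight_nil {u : V} : (nil : G.Walk u u).weight χ = 0 := by
  simp [weight]

@[simp] lemma weight_cons {u v w : V} (h : G.Adj u v) (p : G.Walk v w) :
    (cons h p).weight χ = χ s(u, v) + p.weight χ := by
  simp [weight]

@[simp] lemma weight_append {u v w : V} (p : G.Walk u v) (q : G.Walk v w) :
    (p.append q).weight χ = p.weight χ + q.weight χ := by
  simp [weight]

/-- A weight that is a coboundary along a walk telescopes. -/
lemma weight_eq_of_coboundary {g : V → ZMod 2} {u v : V} (p : G.Walk u v)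
    (h : ∀ a b, s(a, b) ∈ p.edges → χ s(a, b) = g a + g b) :
    p.weight χ = g u + g v := by
  induction p with
  | nil => simp [CharTwo.add_self_eq_zero]
  | @cons a b c hab p ih =>
    rw [weight_cons, h a b (by simp), ih fun a b hp => h a b (by simp [hp])]
    linear_combination CharTwo.add_self_eq_zero (g b)

lemma weight_eq_zero {u v : V} (p : G.Walk u v) (h : ∀ e ∈ p.edges, χ e = 0) :
    p.weight χ = 0 := by
  simpa using p.weight_eq_of_coboundary (g := 0) fun a b hp => by simpa using h _ hp

/-- A path that traverses an edge joining its two endpoints consists of that edge. -/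
lemma IsPath.edges_eq_singleton {u v : V} {p : G.Walk v u} (hp : p.IsPath)
    (h : s(u, v) ∈ p.edges) : p.edges = [s(u, v)] := by
  cases p with
  | nil => simp at h
  | @cons _ w _ hvw q =>
    rw [cons_isPath_iff] at hp
    have huw : u = w := by
      rw [edges_cons, List.mem_cons] at h
      rcases h with h | h
      · have := hvw.ne
        grind [Sym2.eq_iff]
      · exact absurd (q.snd_mem_support_of_mem_edges h) hp.2
    subst huw
    rw [eq_nil_iff_nil.2 (isPath_iff_nil.1 hp.1)]
    simp [Sym2.eq_swap]

lemma weight_bypass [DecidableEq V]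
    (hcyc : ∀ ⦃u : V⦄ (W : G.Walk u u), W.IsCycle → W.weight χ = 0) {u v : V}
    (p : G.Walk u v) : p.bypass.weight χ = p.weight χ := by
  induction p with
  | nil => simp [bypass]
  | @cons a b c hab p ih =>
    rw [weight_cons, ← ih, bypass]
    split_ifs with hs
    · have hpath : (p.bypass.takeUntil a hs).IsPath := p.bypass_isPath.takeUntil hs
      have hsplit : p.bypass.weight χ = _ :=
        (congrArg (weight χ) (p.bypass.take_spec hs)).symm.trans (weight_append _ _)
      have hclosed : χ s(a, b) + (p.bypass.takeUntil a hs).weight χ = 0 := by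
        by_cases he : s(a, b) ∈ (p.bypass.takeUntil a hs).edges
        · simp [weight, hpath.edges_eq_singleton he, CharTwo.add_self_eq_zero]
        · simpa using hcyc _ ((cons_isCycle_iff _ hab).2 ⟨hpath, he⟩)
      rw [hsplit, ← add_assoc, hclosed, zero_add]
    · simp

/-- A weight vanishing on all cycles vanishes on all closed walks. -/
lemma weight_closed (hcyc : ∀ ⦃u : V⦄ (W : G.Walk u u), W.IsCycle → W.weight χ = 0) {u : V}
    (p : G.Walk u u) : p.weight χ = 0 := by
  classical
  rw [← weight_bypass hcyc, eq_nil_iff_nil.2 (isPath_iff_nil.1 p.bypass_isPath), weight_nil]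

lemma IsCycle.weight_eq_sum_edgeVec {u : V} {W : G.Walk u u} (hW : W.IsCycle)
    {T : Finset (Sym2 V)} (hT : ∀ e ∈ W.edges, e ∈ T) :
    W.weight χ = ∑ e ∈ T, χ e * edgeVec G W e := by
  classical
  have hsub : W.edges.toFinset ⊆ T := fun e he => hT e (by simpa using he)
  rw [weight, ← List.sum_toFinset χ hW.edges_nodup, ← Finset.sum_subset hsub]
  · refine Finset.sum_congr rfl fun e he => ?_
    rw [edgeVec, if_pos (by simpa using he), mul_one]
  · intro e _ he
    rw [edgeVec, if_neg (by simpa using he), mul_zero]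

end

end SimpleGraph.Walk

open SimpleGraph

/-- A weight vanishing on a generating set of cycles vanishes on all cycles. -/
lemma GeneratesCycleSpace.weight_eq_zero {V : Type} {G : SimpleGraph V}
    {𝒞 : Set (Σ v : V, G.Walk v v)} (hgen : GeneratesCycleSpace G 𝒞) {χ : Sym2 V → ZMod 2}
    (h : ∀ O ∈ 𝒞, O.2.weight χ = 0) ⦃u : V⦄ (W : G.Walk u u) (hW : W.IsCycle) :
    W.weight χ = 0 := by
  classical
  obtain ⟨s, hs, hsum⟩ := hgen.2 W hW
  set T : Finset (Sym2 V) := W.edges.toFinset ∪ s.biUnion fun O => O.2.edges.toFinset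
  have hO : ∀ O ∈ s, ∑ e ∈ T, χ e * edgeVec G O.2 e = 0 := fun O hOs => by
    rw [← (hgen.1 O (hs hOs)).weight_eq_sum_edgeVec, h O (hs hOs)]
    intro e he
    simp only [T, Finset.mem_union, Finset.mem_biUnion, List.mem_toFinset]
    exact Or.inr ⟨O, hOs, he⟩
  rw [hW.weight_eq_sum_edgeVec (T := T) fun e he => by simp [T, he]]
  simp_rw [hsum, Finset.mul_sum]
  rw [Finset.sum_comm]
  exact Finset.sum_eq_zero hO

/-- Removing an edge from a cycle leaves a walk between its endpoints along the other edges. -/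
lemma SimpleGraph.Walk.IsCycle.exists_walk_avoiding_edge {V : Type} {G Gp : SimpleGraph V}
    {w u v : V} {W : Gp.Walk w w} (hW : W.IsCycle) (he : s(u, v) ∈ W.edges)
    (hG : ∀ f ∈ W.edges, f ≠ s(u, v) → f ∈ G.edgeSet) :
    ∃ p : G.Walk u v, ∀ f ∈ p.edges, f ∈ W.edges := by
  set K : SimpleGraph V := fromEdgeSet {f | f ∈ W.edges}
  have hWK : ∀ f ∈ W.edges, f ∈ K.edgeSet := fun f hf => by
    rw [edgeSet_fromEdgeSet]
    exact ⟨hf, Gp.not_isDiag_of_mem_edgeSet (W.edges_subset_edgeSet hf)⟩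
  obtain ⟨-, ⟨p⟩⟩ := (adj_and_reachable_delete_edges_iff_exists_cycle (G := K)).2
    ⟨w, W.transfer K hWK, hW.transfer hWK, by simpa using he⟩
  have hp : ∀ f ∈ p.edges, f ∈ W.edges ∧ f ≠ s(u, v) := fun f hf => by
    have := p.edges_subset_edgeSet hf
    rw [edgeSet_deleteEdges, edgeSet_fromEdgeSet] at this
    exact ⟨this.1.1, this.2⟩
  exact ⟨p.transfer G fun f hf => hG f (hp f hf).1 (hp f hf).2,
    fun f hf => (hp f (by simpa using hf)).1⟩

open Classical in
/-- The indicator of the pairs joining `A` to `C`. -/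
noncomputable def crossing {V : Type} (A C : Set V) (e : Sym2 V) : ZMod 2 :=
  if ∃ a ∈ A, ∃ c ∈ C, e = s(a, c) then 1 else 0

/-- Let `D` be a union of components of `G` minus `C`. If `A` is closed under passing to
`G`-neighbours in `B`, then on edges whose endpoints in `D` lie in `B` the indicator of the edges
from `A` to `C` is the coboundary of the indicator of `A`. -/
lemma crossing_eq_indicator_add {V : Type} {G : SimpleGraph V} {A B C D : Set V}
    (hDC : Disjoint D C) (hD : ∀ ⦃a b⦄, G.Adj a b → a ∈ D → b ∉ C → b ∈ D)
    (hAB : A ⊆ B) (hBD : B ⊆ D) (hA : ∀ ⦃a b⦄, G.Adj a b → a ∈ A → b ∈ B → b ∈ A)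
    {u v : V} (huv : G.Adj u v) (hu : u ∈ D → u ∈ B) (hv : v ∈ D → v ∈ B) :
    crossing A C s(u, v) = A.indicator 1 u + A.indicator 1 v := by
  classical
  have hAC : ∀ a ∈ A, a ∉ C := fun a ha => Set.disjoint_left.1 hDC (hBD (hAB ha))
  have hout : ∀ ⦃a b⦄, G.Adj a b → a ∈ A → (b ∈ D → b ∈ B) → b ∉ A → b ∈ C :=
    fun a b hab ha hb hbA => by_contra fun hbC =>
      hbA (hA hab ha (hb (hD hab (hBD (hAB ha)) hbC)))
  have h11 : (1 : ZMod 2) + 1 = 0 := rfl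
  have hiff : (∃ a ∈ A, ∃ c ∈ C, s(u, v) = s(a, c)) ↔ (u ∈ A ∧ v ∈ C) ∨ (v ∈ A ∧ u ∈ C) := by
    constructor
    · rintro ⟨a, ha, c, hc, h⟩
      rcases Sym2.eq_iff.1 h with ⟨rfl, rfl⟩ | ⟨rfl, rfl⟩
      exacts [Or.inl ⟨ha, hc⟩, Or.inr ⟨ha, hc⟩]
    · rintro (⟨ha, hc⟩ | ⟨ha, hc⟩)
      exacts [⟨u, ha, v, hc, rfl⟩, ⟨v, ha, u, hc, Sym2.eq_swap⟩]
  have huo := hout huv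
  have hvo := hout huv.symm
  have huC := hAC u
  have hvC := hAC v
  simp only [crossing, hiff, Set.indicator_apply, Pi.one_apply]
  by_cases h1 : u ∈ A <;> by_cases h2 : v ∈ A <;> simp_all

/-- Generalized Kesten theorem.  Let `Gp` be a locally finite connected graph
and `G` a connected spanning subgraph.  Suppose some set `𝒞` of cycles of `G`
generating the cycle space of `G` over GF(2) is chordal in `Gp`, and every edge
`e` of `Gp` lies on a cycle of `Gp`, chordal in `Gp`, all of whose other edges
are edges of `G`.  Then for every nonempty connected set of vertices `C` of `Gp`
and every vertex `x ∉ C`, the set `∂^{G⁺}_{vis_G(x)}(C)` induces a connected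
subgraph of `G`. -/
theorem visBoundary2_connected_in_subgraph
    {V : Type} (G Gp : SimpleGraph V) (hle : G ≤ Gp)
    (hGpconn : Gp.Connected) (hGconn : G.Connected)
    (hlf : ∀ v : V, (Gp.neighborSet v).Finite)
    (𝒞 : Set (Σ v : V, G.Walk v v)) (hgen : GeneratesCycleSpace G 𝒞)
    (hchordal : ∀ O ∈ 𝒞, ∀ a ∈ O.2.support, ∀ b ∈ O.2.support, a ≠ b → Gp.Adj a b)
    (O : (e : Sym2 V) → e ∈ Gp.edgeSet → Σ v : V, Gp.Walk v v)
    (hO : ∀ (e : Sym2 V) (he : e ∈ Gp.edgeSet),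
      (O e he).2.IsCycle ∧ e ∈ (O e he).2.edges ∧
        (∀ f ∈ (O e he).2.edges, f ≠ e → f ∈ G.edgeSet) ∧
        ∀ a ∈ (O e he).2.support, ∀ b ∈ (O e he).2.support, a ≠ b → Gp.Adj a b)
    (C : Set V) (hCne : C.Nonempty) (hCconn : (Gp.induce C).Connected)
    (x : V) (hx : x ∉ C) :
    (G.induce (visBoundary2 G Gp C x)).Connected := by
  classical
  set B : Set V := visBoundary2 G Gp C x
  set D : Set V := {y | ∃ p : G.Walk x y, ∀ v ∈ p.support, v ∉ C}
  have hDC : Disjoint D C := Set.disjoint_left.2 fun y ⟨p, hp⟩ => hp y p.end_mem_support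
  have hD : ∀ ⦃a b⦄, G.Adj a b → a ∈ D → b ∉ C → b ∈ D := by
    rintro a b hab ⟨p, hp⟩ hb
    refine ⟨p.concat hab, fun v hv => ?_⟩
    rw [Walk.support_concat, List.mem_append, List.mem_singleton] at hv
    rcases hv with hv | rfl
    exacts [hp v hv, hb]
  have hBD : B ⊆ D := fun y hy => hy.2
  have hBne : B.Nonempty := by
    obtain ⟨c, hc⟩ := hCne
    obtain ⟨p⟩ := hGconn.preconnected x c
    obtain ⟨d, -, hd1, hd2⟩ := p.exists_boundary_dart D
      ⟨Walk.nil, by simpa using hx⟩ fun h => Set.disjoint_left.1 hDC h hc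
    exact ⟨d.fst, ⟨d.snd, by_contra fun h => hd2 (hD d.adj hd1 h), hle d.adj⟩, hd1⟩
  have := hBne.to_subtype
  refine ⟨fun b₁ b₂ => by_contra fun hnot => ?_⟩
  set A : Set V := {v | ∃ h : v ∈ B, (G.induce B).Reachable b₁ ⟨v, h⟩}
  have hAB : A ⊆ B := fun v hv => hv.1
  have hA : ∀ ⦃a b⦄, G.Adj a b → a ∈ A → b ∈ B → b ∈ A := fun a b hab ⟨ha, hr⟩ hb =>
    ⟨hb, hr.trans (Adj.reachable (G := G.induce B) (u := ⟨a, ha⟩) (v := ⟨b, hb⟩) hab)⟩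
  have hA₁ : (b₁ : V) ∈ A := ⟨b₁.2, Reachable.refl _⟩
  have hA₂ : (b₂ : V) ∉ A := fun ⟨_, h⟩ => hnot h
  have hAC : ∀ c ∈ C, c ∉ A := fun c hc hcA => Set.disjoint_left.1 hDC (hBD (hAB hcA)) hc
  have hlocal : ∀ c ∈ C, ∀ {u v : V} (p : G.Walk u v),
      (∀ a b, s(a, b) ∈ p.edges → (a ≠ c → Gp.Adj a c) ∧ (b ≠ c → Gp.Adj b c)) →
      p.weight (crossing A C) = A.indicator 1 u + A.indicator 1 v := by
    intro c hc u v p hp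
    have hB : ∀ a, (a ≠ c → Gp.Adj a c) → a ∈ D → a ∈ B := fun a ha haD =>
      ⟨⟨c, hc, ha (by rintro rfl; exact Set.disjoint_left.1 hDC haD hc)⟩, haD⟩
    exact p.weight_eq_of_coboundary fun a b hab =>
      crossing_eq_indicator_add hDC hD hAB hBD hA (p.adj_of_mem_edges hab)
        (hB a (hp a b hab).1) (hB b (hp a b hab).2)
  have hgenerators : ∀ W ∈ 𝒞, W.2.weight (crossing A C) = 0 := by
    intro W hW
    by_cases hWC : ∃ c ∈ W.2.support, c ∈ C
    · obtain ⟨c, hcW, hc⟩ := hWC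
      rw [hlocal c hc W.2 fun a b hab =>
        ⟨hchordal W hW a (W.2.fst_mem_support_of_mem_edges hab) c hcW,
          hchordal W hW b (W.2.snd_mem_support_of_mem_edges hab) c hcW⟩]
      exact CharTwo.add_self_eq_zero _
    · refine W.2.weight_eq_zero fun e he => if_neg ?_
      rintro ⟨a, -, c, hc, rfl⟩
      exact hWC ⟨c, W.2.snd_mem_support_of_mem_edges he, hc⟩
  have hclosed : ∀ {u : V} (p : G.Walk u u), p.weight (crossing A C) = 0 := fun p =>
    p.weight_closed (hgen.weight_eq_zero hgenerators)
  have hedge : ∀ c ∈ C, ∀ u, Gp.Adj u c →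
      ∃ p : G.Walk u c, p.weight (crossing A C) = A.indicator 1 u := by
    intro c hc u huc
    obtain ⟨hcyc, hmem, hother, hch⟩ := hO s(u, c) huc
    obtain ⟨p, hp⟩ := hcyc.exists_walk_avoiding_edge hmem hother
    have hcO := Walk.snd_mem_support_of_mem_edges _ hmem
    refine ⟨p, (hlocal c hc p fun a b hab => ?_).trans ?_⟩
    · exact ⟨hch a (Walk.fst_mem_support_of_mem_edges _ (hp _ hab)) c hcO,
        hch b (Walk.snd_mem_support_of_mem_edges _ (hp _ hab)) c hcO⟩
    · rw [Set.indicator_of_notMem (hAC c hc), add_zero]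
  have hC : ∀ {c c' : C} (_ : (Gp.induce C).Walk c c'),
      ∃ p : G.Walk c c', p.weight (crossing A C) = 0 := by
    intro c c' q
    induction q with
    | nil => exact ⟨Walk.nil, Walk.weight_nil⟩
    | @cons a b d hab q ih =>
      obtain ⟨p, hp⟩ := ih
      obtain ⟨r, hr⟩ := hedge b b.2 a hab
      refine ⟨r.append p, ?_⟩
      rw [Walk.weight_append, hr, hp, Set.indicator_of_notMem (hAC a a.2), add_zero]
  have hjoin : ∀ {u v : V} (p : G.Walk u v), (∀ w ∈ p.support, w ∉ C) →
      p.weight (crossing A C) = 0 := by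
    intro u v p hp
    refine p.weight_eq_zero fun e he => if_neg ?_
    rintro ⟨a, -, c, hc, rfl⟩
    exact hp c (p.snd_mem_support_of_mem_edges he) hc
  obtain ⟨⟨c₁, hc₁, hbc₁⟩, p₁, hp₁⟩ := b₁.2
  obtain ⟨⟨c₂, hc₂, hbc₂⟩, p₂, hp₂⟩ := b₂.2
  obtain ⟨r₁, hr₁⟩ := hedge c₁ hc₁ b₁ hbc₁
  obtain ⟨r₂, hr₂⟩ := hedge c₂ hc₂ b₂ hbc₂
  obtain ⟨q⟩ := hCconn.preconnected ⟨c₁, hc₁⟩ ⟨c₂, hc₂⟩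
  obtain ⟨r, hr⟩ := hC q
  have hreverse : r₂.reverse.weight (crossing A C) = r₂.weight (crossing A C) := by
    simp [Walk.weight]
  have hp₂' := hjoin p₂.reverse (by simpa using hp₂)
  have h := hclosed
    (p₁.append (r₁.append (r.append (r₂.reverse.append p₂.reverse))))
  simp [hjoin p₁ hp₁, hp₂', hr₁, hr, hreverse, hr₂, hA₁, hA₂] at h
end
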